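/- arXiv:2108.07602 — 9 statements merged into one kernel-verified Lean document; each statement's English description precedes it below -/
import Mathlib

section
/- Let s₁ ∈ [0,1] be a fixed defender strategy. Then r₁* = 0 is the unique best response of the adversary to s₁ if and only if ASR(s₁) < μ^adv. -/
noncomputable def ASR (rob₁ rob₂ s₁ : ℝ) : ℝ := 1 - (s₁ * rob₁ + (1 - s₁) * rob₂)

noncomputable def muAdv (Oadv Rp Rm : ℝ) : ℝ := (Oadv + Rm) / (Rp + Rm)

noncomputable def UtilityAdv (rob₁ rob₂ Oadv Rp Rm Iadv : ℝ) (n : ℕ) (rmax s₁ r₁ : ℝ) : ℝ :=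
  -Iadv + (n : ℝ) * rmax * r₁ * (-Oadv - Rm + (Rp + Rm) * ASR rob₁ rob₂ s₁)

def IsBestRespAdv (rob₁ rob₂ Oadv Rp Rm Iadv : ℝ) (n : ℕ) (rmax s₁ r₁ : ℝ) : Prop :=
  r₁ ∈ Set.Icc (0:ℝ) 1 ∧
  ∀ r ∈ Set.Icc (0:ℝ) 1,
    UtilityAdv rob₁ rob₂ Oadv Rp Rm Iadv n rmax s₁ r ≤
      UtilityAdv rob₁ rob₂ Oadv Rp Rm Iadv n rmax s₁ r₁

theorem stmt_0 (rob₁ rob₂ Oadv Rp Rm Iadv rmax : ℝ) (n : ℕ)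
    (hrob₁ : rob₁ ∈ Set.Icc (0:ℝ) 1) (hrob₂ : rob₂ ∈ Set.Icc (0:ℝ) 1) (hrr : rob₁ < rob₂)
    (hO : 0 ≤ Oadv) (hRp : 0 ≤ Rp) (hRm : 0 ≤ Rm) (hR : 0 < Rp + Rm)
    (hI : 0 ≤ Iadv) (hn : 1 ≤ n) (hrmax : rmax ∈ Set.Ioc (0:ℝ) 1)
    (s₁ : ℝ) (hs₁ : s₁ ∈ Set.Icc (0:ℝ) 1) :
    (IsBestRespAdv rob₁ rob₂ Oadv Rp Rm Iadv n rmax s₁ 0 ∧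
      ∀ r₁ : ℝ, IsBestRespAdv rob₁ rob₂ Oadv Rp Rm Iadv n rmax s₁ r₁ → r₁ = 0) ↔
    ASR rob₁ rob₂ s₁ < muAdv Oadv Rp Rm := by
  have hk : 0 < (n : ℝ) * rmax := mul_pos (by exact_mod_cast hn) hrmax.1
  unfold IsBestRespAdv UtilityAdv muAdv
  rw [lt_div_iff₀ hR]
  generalize ASR rob₁ rob₂ s₁ = A
  generalize (n : ℝ) * rmax = k at hk
  constructor
  · rintro ⟨-, h2⟩
    by_contra hc
    have hc' : 0 ≤ -Oadv - Rm + (Rp + Rm) * A := by linarith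
    have h := h2 1 ⟨⟨by norm_num, le_rfl⟩, fun r hr => by
      have h1 := mul_le_mul_of_nonneg_right
        (mul_le_mul_of_nonneg_left hr.2 hk.le) hc'
      linarith⟩
    norm_num at h
  · intro h
    have hc : -Oadv - Rm + (Rp + Rm) * A < 0 := by linarith
    refine ⟨⟨⟨le_rfl, by norm_num⟩, fun r hr => ?_⟩, ?_⟩
    · have h1 := mul_nonpos_of_nonneg_of_nonpos (mul_nonneg hk.le hr.1) hc.le
      linarith
    · rintro r ⟨hr, h2⟩
      by_contra hne
      have hpos : 0 < r := lt_of_le_of_ne hr.1 (Ne.symm hne)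
      have h1 := mul_neg_of_pos_of_neg (mul_pos hk hpos) hc
      have h3 := h2 0 ⟨le_rfl, by norm_num⟩
      linarith
end

section
/- Let s₁ ∈ [0,1] be a fixed defender strategy. Then r₁* = 1 is the unique best response of the adversary to s₁ if and only if ASR(s₁) > μ^adv. -/
theorem stmt_1 (rob₁ rob₂ Oadv Rp Rm Iadv rmax : ℝ) (n : ℕ)
    (hrob₁ : rob₁ ∈ Set.Icc (0:ℝ) 1) (hrob₂ : rob₂ ∈ Set.Icc (0:ℝ) 1) (hrr : rob₁ < rob₂)
    (hO : 0 ≤ Oadv) (hRp : 0 ≤ Rp) (hRm : 0 ≤ Rm) (hR : 0 < Rp + Rm)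
    (hI : 0 ≤ Iadv) (hn : 1 ≤ n) (hrmax : rmax ∈ Set.Ioc (0:ℝ) 1)
    (s₁ : ℝ) (hs₁ : s₁ ∈ Set.Icc (0:ℝ) 1) :
    (IsBestRespAdv rob₁ rob₂ Oadv Rp Rm Iadv n rmax s₁ 1 ∧
      ∀ r₁ : ℝ, IsBestRespAdv rob₁ rob₂ Oadv Rp Rm Iadv n rmax s₁ r₁ → r₁ = 1) ↔
    ASR rob₁ rob₂ s₁ > muAdv Oadv Rp Rm := by
  have hn' : (0:ℝ) < (n:ℝ) := by exact_mod_cast hn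
  have hk : 0 < (n:ℝ) * rmax := mul_pos hn' hrmax.1
  have hmu : ASR rob₁ rob₂ s₁ > muAdv Oadv Rp Rm ↔
      0 < -Oadv - Rm + (Rp + Rm) * ASR rob₁ rob₂ s₁ := by
    unfold muAdv
    rw [gt_iff_lt, div_lt_iff₀ hR]
    constructor <;> intro h <;> linarith
  rw [hmu]
  unfold IsBestRespAdv UtilityAdv
  generalize -Oadv - Rm + (Rp + Rm) * ASR rob₁ rob₂ s₁ = c
  generalize (n:ℝ) * rmax = k at hk
  constructor
  · rintro ⟨-, h2⟩
    by_contra hc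
    have hkc : k * c ≤ 0 := mul_nonpos_of_nonneg_of_nonpos hk.le (not_lt.mp hc)
    have h0 := h2 0 ⟨by simp, fun r hr => by nlinarith [mul_nonneg hr.1 (neg_nonneg.mpr hkc)]⟩
    exact zero_ne_one h0
  · intro hc
    have hkc : 0 < k * c := mul_pos hk hc
    refine ⟨⟨by simp, fun r hr => by nlinarith [mul_nonneg (sub_nonneg.mpr hr.2) hkc.le]⟩, ?_⟩
    rintro r ⟨hr, h⟩
    have h1 := h 1 (by simp)
    refine le_antisymm hr.2 (le_of_mul_le_mul_right ?_ hkc)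
    linarith
end

section
/- Let r₁ ∈ [0,1] be a fixed adversary strategy. Then s₁* = 0 is the unique best response of the defender to r₁ if and only if ΔCCR(r₁; r_max) < Δμ^def. -/
noncomputable def CCR (acc rob r₁ rmax : ℝ) : ℝ := (1 - r₁ * rmax) * acc + r₁ * rmax * rob

noncomputable def muDef (Odef Rp Rm : ℝ) : ℝ := (Odef + Rm) / (Rp + Rm)

noncomputable def EPPSdef (acc rob Odef Rp Rm r₁ rmax : ℝ) : ℝ :=
  -Odef - Rm + (Rp + Rm) * CCR acc rob r₁ rmax

noncomputable def UtilityDef (acc₁ acc₂ rob₁ rob₂ O₁ O₂ Rp Rm Idef : ℝ) (n : ℕ)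
    (rmax s₁ r₁ : ℝ) : ℝ :=
  -Idef + (n : ℝ) * (s₁ * EPPSdef acc₁ rob₁ O₁ Rp Rm r₁ rmax +
    (1 - s₁) * EPPSdef acc₂ rob₂ O₂ Rp Rm r₁ rmax)

def IsBestRespDef (acc₁ acc₂ rob₁ rob₂ O₁ O₂ Rp Rm Idef : ℝ) (n : ℕ)
    (rmax r₁ s₁ : ℝ) : Prop :=
  s₁ ∈ Set.Icc (0:ℝ) 1 ∧
  ∀ s ∈ Set.Icc (0:ℝ) 1,
    UtilityDef acc₁ acc₂ rob₁ rob₂ O₁ O₂ Rp Rm Idef n rmax s r₁ ≤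
      UtilityDef acc₁ acc₂ rob₁ rob₂ O₁ O₂ Rp Rm Idef n rmax s₁ r₁

theorem stmt_6 (acc₁ acc₂ rob₁ rob₂ O₁ O₂ Rp Rm Idef rmax : ℝ) (n : ℕ)
    (hacc₁ : acc₁ ∈ Set.Icc (0:ℝ) 1) (hacc₂ : acc₂ ∈ Set.Icc (0:ℝ) 1)
    (hrob₁ : rob₁ ∈ Set.Icc (0:ℝ) 1) (hrob₂ : rob₂ ∈ Set.Icc (0:ℝ) 1)
    (h12 : acc₁ > acc₂) (h2r : acc₂ > rob₂) (hrr : rob₂ > rob₁)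
    (hO₁ : 0 ≤ O₁) (hO₂ : 0 ≤ O₂) (hRp : 0 ≤ Rp) (hRm : 0 ≤ Rm) (hR : 0 < Rp + Rm)
    (hI : 0 ≤ Idef) (hn : 1 ≤ n) (hrmax : rmax ∈ Set.Icc (0:ℝ) 1)
    (r₁ : ℝ) (hr₁ : r₁ ∈ Set.Icc (0:ℝ) 1) :
    (IsBestRespDef acc₁ acc₂ rob₁ rob₂ O₁ O₂ Rp Rm Idef n rmax r₁ 0 ∧
      ∀ s₁ : ℝ, IsBestRespDef acc₁ acc₂ rob₁ rob₂ O₁ O₂ Rp Rm Idef n rmax r₁ s₁ → s₁ = 0) ↔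
    CCR acc₁ rob₁ r₁ rmax - CCR acc₂ rob₂ r₁ rmax < muDef O₁ Rp Rm - muDef O₂ Rp Rm := by
  have hn' : (0:ℝ) < n := by exact_mod_cast hn
  have key : (CCR acc₁ rob₁ r₁ rmax - CCR acc₂ rob₂ r₁ rmax < muDef O₁ Rp Rm - muDef O₂ Rp Rm) ↔
      EPPSdef acc₁ rob₁ O₁ Rp Rm r₁ rmax < EPPSdef acc₂ rob₂ O₂ Rp Rm r₁ rmax := by
    unfold muDef EPPSdef
    rw [← sub_div, lt_div_iff₀ hR]
    constructor <;> intro h <;> linarith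
  rw [key]
  unfold IsBestRespDef UtilityDef
  generalize EPPSdef acc₁ rob₁ O₁ Rp Rm r₁ rmax = A
  generalize EPPSdef acc₂ rob₂ O₂ Rp Rm r₁ rmax = B
  have cmp : ∀ s t : ℝ, (-Idef + (n:ℝ) * (s * A + (1 - s) * B) ≤
      -Idef + (n:ℝ) * (t * A + (1 - t) * B)) ↔ 0 ≤ (t - s) * (A - B) := by
    intro s t
    rw [add_le_add_iff_left, mul_le_mul_iff_right₀ hn']
    constructor <;> intro h <;> linarith
  simp only [cmp]
  constructor
  · rintro ⟨-, h2⟩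
    by_contra hAB
    have h1 : (1:ℝ) = 0 := by
      refine h2 1 ⟨by norm_num, ?_⟩
      intro s hs
      exact mul_nonneg (by linarith [hs.2]) (by linarith)
    norm_num at h1
  · intro hAB
    refine ⟨⟨by norm_num, ?_⟩, ?_⟩
    · intro s hs
      exact mul_nonneg_of_nonpos_of_nonpos (by linarith [hs.1]) (by linarith)
    · rintro s ⟨hs, h⟩
      have h0 := h 0 (by norm_num)
      by_contra hne
      have hpos : 0 < s := lt_of_le_of_ne hs.1 (Ne.symm hne)
      nlinarith
end

section
/- Let r₁ ∈ [0,1] be a fixed adversary strategy. Then s₁* = 1 is the unique best response of the defender to r₁ if and only if ΔCCR(r₁; r_max) > Δμ^def. -/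
theorem stmt_7 (acc₁ acc₂ rob₁ rob₂ O₁ O₂ Rp Rm Idef rmax : ℝ) (n : ℕ)
    (hacc₁ : acc₁ ∈ Set.Icc (0:ℝ) 1) (hacc₂ : acc₂ ∈ Set.Icc (0:ℝ) 1)
    (hrob₁ : rob₁ ∈ Set.Icc (0:ℝ) 1) (hrob₂ : rob₂ ∈ Set.Icc (0:ℝ) 1)
    (h12 : acc₁ > acc₂) (h2r : acc₂ > rob₂) (hrr : rob₂ > rob₁)
    (hO₁ : 0 ≤ O₁) (hO₂ : 0 ≤ O₂) (hRp : 0 ≤ Rp) (hRm : 0 ≤ Rm) (hR : 0 < Rp + Rm)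
    (hI : 0 ≤ Idef) (hn : 1 ≤ n) (hrmax : rmax ∈ Set.Icc (0:ℝ) 1)
    (r₁ : ℝ) (hr₁ : r₁ ∈ Set.Icc (0:ℝ) 1) :
    (IsBestRespDef acc₁ acc₂ rob₁ rob₂ O₁ O₂ Rp Rm Idef n rmax r₁ 1 ∧
      ∀ s₁ : ℝ, IsBestRespDef acc₁ acc₂ rob₁ rob₂ O₁ O₂ Rp Rm Idef n rmax r₁ s₁ → s₁ = 1) ↔
    CCR acc₁ rob₁ r₁ rmax - CCR acc₂ rob₂ r₁ rmax > muDef O₁ Rp Rm - muDef O₂ Rp Rm := by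
  have hn' : (0:ℝ) < n := by exact_mod_cast hn
  have key : EPPSdef acc₁ rob₁ O₁ Rp Rm r₁ rmax - EPPSdef acc₂ rob₂ O₂ Rp Rm r₁ rmax =
      (Rp + Rm) * ((CCR acc₁ rob₁ r₁ rmax - CCR acc₂ rob₂ r₁ rmax) -
        (muDef O₁ Rp Rm - muDef O₂ Rp Rm)) := by
    unfold EPPSdef muDef
    field_simp
    ring
  have hU : ∀ s t : ℝ, UtilityDef acc₁ acc₂ rob₁ rob₂ O₁ O₂ Rp Rm Idef n rmax s r₁ -
      UtilityDef acc₁ acc₂ rob₁ rob₂ O₁ O₂ Rp Rm Idef n rmax t r₁ =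
      (s - t) * ((n : ℝ) * (Rp + Rm) * ((CCR acc₁ rob₁ r₁ rmax - CCR acc₂ rob₂ r₁ rmax) -
        (muDef O₁ Rp Rm - muDef O₂ Rp Rm))) := by
    intro s t
    rw [mul_assoc, ← key]
    unfold UtilityDef
    ring
  have hc : 0 < (n : ℝ) * (Rp + Rm) := mul_pos hn' hR
  constructor
  · rintro ⟨-, h2⟩
    by_contra hD
    have h0 : (n : ℝ) * (Rp + Rm) * ((CCR acc₁ rob₁ r₁ rmax - CCR acc₂ rob₂ r₁ rmax) -
        (muDef O₁ Rp Rm - muDef O₂ Rp Rm)) ≤ 0 :=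
      mul_nonpos_of_nonneg_of_nonpos hc.le (by linarith [not_lt.mp hD])
    have := h2 0 ⟨⟨le_refl _, zero_le_one⟩, fun s hs => by
      have h := hU s 0
      have h' := mul_nonpos_of_nonneg_of_nonpos (sub_nonneg.mpr hs.1) h0
      linarith⟩
    norm_num at this
  · intro hD
    have h0 := mul_pos hc (sub_pos.mpr hD)
    refine ⟨⟨⟨zero_le_one, le_refl _⟩, fun s hs => ?_⟩, fun s hs => ?_⟩
    · have h := hU 1 s
      have h' := mul_nonneg (sub_nonneg.mpr hs.2) h0.le
      linarith
    · by_contra hne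
      have hlt : s < 1 := lt_of_le_of_ne hs.1.2 hne
      have h := hU 1 s
      have h' := mul_pos (sub_pos.mpr hlt) h0
      have := hs.2 1 ⟨zero_le_one, le_refl _⟩
      linarith
end

section
/- Let r₁ ∈ [0,1] be a fixed adversary strategy. Then every s₁ ∈ [0,1] is a best response of the defender to r₁ if and only if ΔCCR(r₁; r_max) = Δμ^def. -/
theorem stmt_8 (acc₁ acc₂ rob₁ rob₂ O₁ O₂ Rp Rm Idef rmax : ℝ) (n : ℕ)
    (hacc₁ : acc₁ ∈ Set.Icc (0:ℝ) 1) (hacc₂ : acc₂ ∈ Set.Icc (0:ℝ) 1)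
    (hrob₁ : rob₁ ∈ Set.Icc (0:ℝ) 1) (hrob₂ : rob₂ ∈ Set.Icc (0:ℝ) 1)
    (h12 : acc₁ > acc₂) (h2r : acc₂ > rob₂) (hrr : rob₂ > rob₁)
    (hO₁ : 0 ≤ O₁) (hO₂ : 0 ≤ O₂) (hRp : 0 ≤ Rp) (hRm : 0 ≤ Rm) (hR : 0 < Rp + Rm)
    (hI : 0 ≤ Idef) (hn : 1 ≤ n) (hrmax : rmax ∈ Set.Icc (0:ℝ) 1)
    (r₁ : ℝ) (hr₁ : r₁ ∈ Set.Icc (0:ℝ) 1) :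
    (∀ s₁ ∈ Set.Icc (0:ℝ) 1, IsBestRespDef acc₁ acc₂ rob₁ rob₂ O₁ O₂ Rp Rm Idef n rmax r₁ s₁) ↔
    CCR acc₁ rob₁ r₁ rmax - CCR acc₂ rob₂ r₁ rmax = muDef O₁ Rp Rm - muDef O₂ Rp Rm := by
  have hn' : (0:ℝ) < n := by exact_mod_cast hn
  have key : (CCR acc₁ rob₁ r₁ rmax - CCR acc₂ rob₂ r₁ rmax = muDef O₁ Rp Rm - muDef O₂ Rp Rm) ↔
      EPPSdef acc₁ rob₁ O₁ Rp Rm r₁ rmax = EPPSdef acc₂ rob₂ O₂ Rp Rm r₁ rmax := by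
    unfold muDef EPPSdef
    rw [← sub_div, eq_div_iff hR.ne']
    constructor <;> intro h <;> linarith
  rw [key]
  unfold IsBestRespDef UtilityDef
  constructor
  · intro h
    have h0 := (h 0 (by simp)).2 1 (by simp)
    have h1 := (h 1 (by simp)).2 0 (by simp)
    apply le_antisymm
    · refine le_of_mul_le_mul_left ?_ hn'
      linarith
    · refine le_of_mul_le_mul_left ?_ hn'
      linarith
  · intro h s₁ hs
    refine ⟨hs, fun s _ => le_of_eq ?_⟩
    rw [h]
    ring
end

section
/- There exists an adversary strategy r₁ ∈ [0,1] with ΔCCR(r₁; r_max) < Δμ^def if and only if (Δacc - Δμ^def)/(Δacc + Δrob) < r_max. -/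
theorem stmt_9 (acc₁ acc₂ rob₁ rob₂ rmax Δμdef : ℝ)
    (hacc₁ : acc₁ ∈ Set.Icc (0:ℝ) 1) (hacc₂ : acc₂ ∈ Set.Icc (0:ℝ) 1)
    (hrob₁ : rob₁ ∈ Set.Icc (0:ℝ) 1) (hrob₂ : rob₂ ∈ Set.Icc (0:ℝ) 1)
    (h12 : acc₁ > acc₂) (h2r : acc₂ > rob₂) (hrr : rob₂ > rob₁)
    (hrmax : rmax ∈ Set.Icc (0:ℝ) 1) :
    (∃ r₁ ∈ Set.Icc (0:ℝ) 1, CCR acc₁ rob₁ r₁ rmax - CCR acc₂ rob₂ r₁ rmax < Δμdef) ↔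
    ((acc₁ - acc₂) - Δμdef) / ((acc₁ - acc₂) + (rob₂ - rob₁)) < rmax := by
  have hD : 0 < (acc₁ - acc₂) + (rob₂ - rob₁) := by linarith
  rw [div_lt_iff₀ hD]
  unfold CCR
  constructor
  · rintro ⟨r, ⟨_, hr1⟩, h⟩
    have h1 : 0 ≤ (1 - r) * (rmax * ((acc₁ - acc₂) + (rob₂ - rob₁))) :=
      mul_nonneg (by linarith) (mul_nonneg hrmax.1 hD.le)
    linarith
  · intro h
    exact ⟨1, ⟨zero_le_one, le_refl _⟩, by linarith⟩
end

section
/- There exists an adversary strategy r₁ ∈ [0,1] with ΔCCR(r₁; r_max) = Δμ^def if and only if 0 ≤ (Δacc - Δμ^def)/(Δacc + Δrob) ≤ r_max. -/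
theorem stmt_11 (acc₁ acc₂ rob₁ rob₂ rmax Δμdef : ℝ)
    (hacc₁ : acc₁ ∈ Set.Icc (0:ℝ) 1) (hacc₂ : acc₂ ∈ Set.Icc (0:ℝ) 1)
    (hrob₁ : rob₁ ∈ Set.Icc (0:ℝ) 1) (hrob₂ : rob₂ ∈ Set.Icc (0:ℝ) 1)
    (h12 : acc₁ > acc₂) (h2r : acc₂ > rob₂) (hrr : rob₂ > rob₁)
    (hrmax : rmax ∈ Set.Icc (0:ℝ) 1) :
    (∃ r₁ ∈ Set.Icc (0:ℝ) 1, CCR acc₁ rob₁ r₁ rmax - CCR acc₂ rob₂ r₁ rmax = Δμdef) ↔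
    (0 ≤ ((acc₁ - acc₂) - Δμdef) / ((acc₁ - acc₂) + (rob₂ - rob₁)) ∧
      ((acc₁ - acc₂) - Δμdef) / ((acc₁ - acc₂) + (rob₂ - rob₁)) ≤ rmax) := by
  have hD : 0 < (acc₁ - acc₂) + (rob₂ - rob₁) := by linarith
  obtain ⟨hm0, hm1⟩ := hrmax
  constructor
  · rintro ⟨r, ⟨hr0, hr1⟩, h⟩
    have ht : ((acc₁ - acc₂) - Δμdef) / ((acc₁ - acc₂) + (rob₂ - rob₁)) = r * rmax := by
      rw [div_eq_iff hD.ne', ← h]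
      unfold CCR
      ring
    rw [ht]
    exact ⟨mul_nonneg hr0 hm0, mul_le_of_le_one_left hm0 hr1⟩
  · rintro ⟨h0, h1⟩
    obtain ⟨t, ht⟩ : ∃ t, t = ((acc₁ - acc₂) - Δμdef) / ((acc₁ - acc₂) + (rob₂ - rob₁)) := ⟨_, rfl⟩
    rw [← ht] at h0 h1
    rw [eq_div_iff hD.ne'] at ht
    have hx : t / rmax * rmax = t := by
      rcases hm0.eq_or_lt with h | h
      · have : t = 0 := by linarith
        simp [this]
      · exact div_mul_cancel₀ _ h.ne'
    refine ⟨t / rmax, ⟨div_nonneg h0 hm0, div_le_one_of_le₀ h1 hm0⟩, ?_⟩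
    unfold CCR
    rw [hx]
    linarith
end

section
/- Suppose rob₁ < 1 - μ^adv < rob₂ and 0 < (Δacc - Δμ^def)/(Δacc + Δrob) < r_max. Define s₁* := (rob₂ - 1 + μ^adv)/Δrob and r₁* := (Δacc - Δμ^def)/(r_max·(Δacc + Δrob)). Then s₁*, r₁* ∈ (0,1), and (s₁*, r₁*) is a Nash equilibrium: s₁* is a best response of the defender to r₁* and r₁* is a best response of the adversary to s₁*. (Theorem 1, existence part.) -/
theorem stmt_12 (acc₁ acc₂ rob₁ rob₂ Oadv Rpa Rma Iadv O₁ O₂ Rpd Rmd Idef rmax : ℝ) (n : ℕ)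
    (hacc₁ : acc₁ ∈ Set.Icc (0:ℝ) 1) (hacc₂ : acc₂ ∈ Set.Icc (0:ℝ) 1)
    (hrob₁ : rob₁ ∈ Set.Icc (0:ℝ) 1) (hrob₂ : rob₂ ∈ Set.Icc (0:ℝ) 1)
    (h12 : acc₁ > acc₂) (h2r : acc₂ > rob₂) (hrr : rob₂ > rob₁)
    (hOa : 0 ≤ Oadv) (hRpa : 0 ≤ Rpa) (hRma : 0 ≤ Rma) (hRa : 0 < Rpa + Rma) (hIa : 0 ≤ Iadv)
    (hO₁ : 0 ≤ O₁) (hO₂ : 0 ≤ O₂) (hRpd : 0 ≤ Rpd) (hRmd : 0 ≤ Rmd) (hRd : 0 < Rpd + Rmd)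
    (hId : 0 ≤ Idef) (hn : 1 ≤ n) (hrmax : rmax ∈ Set.Ioc (0:ℝ) 1)
    (hmu1 : rob₁ < 1 - muAdv Oadv Rpa Rma) (hmu2 : 1 - muAdv Oadv Rpa Rma < rob₂)
    (hmix1 : 0 < ((acc₁ - acc₂) - (muDef O₁ Rpd Rmd - muDef O₂ Rpd Rmd)) /
      ((acc₁ - acc₂) + (rob₂ - rob₁)))
    (hmix2 : ((acc₁ - acc₂) - (muDef O₁ Rpd Rmd - muDef O₂ Rpd Rmd)) /
      ((acc₁ - acc₂) + (rob₂ - rob₁)) < rmax)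
    (sStar rStar : ℝ)
    (hs : sStar = (rob₂ - 1 + muAdv Oadv Rpa Rma) / (rob₂ - rob₁))
    (hr : rStar = ((acc₁ - acc₂) - (muDef O₁ Rpd Rmd - muDef O₂ Rpd Rmd)) /
      (rmax * ((acc₁ - acc₂) + (rob₂ - rob₁)))) :
    sStar ∈ Set.Ioo (0:ℝ) 1 ∧ rStar ∈ Set.Ioo (0:ℝ) 1 ∧
    IsBestRespDef acc₁ acc₂ rob₁ rob₂ O₁ O₂ Rpd Rmd Idef n rmax rStar sStar ∧
    IsBestRespAdv rob₁ rob₂ Oadv Rpa Rma Iadv n rmax sStar rStar := by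
  obtain ⟨hm0, hm1⟩ := hrmax
  have hD : 0 < (acc₁ - acc₂) + (rob₂ - rob₁) := by linarith
  have hd : 0 < rob₂ - rob₁ := by linarith
  have hA : muAdv Oadv Rpa Rma * (Rpa + Rma) = Oadv + Rma := by
    unfold muAdv; exact div_mul_cancel₀ _ hRa.ne'
  have hM1 : muDef O₁ Rpd Rmd * (Rpd + Rmd) = O₁ + Rmd := by
    unfold muDef; exact div_mul_cancel₀ _ hRd.ne'
  have hM2 : muDef O₂ Rpd Rmd * (Rpd + Rmd) = O₂ + Rmd := by
    unfold muDef; exact div_mul_cancel₀ _ hRd.ne'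
  generalize muAdv Oadv Rpa Rma = a at *
  generalize muDef O₁ Rpd Rmd = m₁ at *
  generalize muDef O₂ Rpd Rmd = m₂ at *
  have hs' : sStar * (rob₂ - rob₁) = rob₂ - 1 + a := by
    rw [hs]; exact div_mul_cancel₀ _ hd.ne'
  have hr' : rStar * (rmax * ((acc₁ - acc₂) + (rob₂ - rob₁))) = (acc₁ - acc₂) - (m₁ - m₂) := by
    rw [hr]; exact div_mul_cancel₀ _ (mul_pos hm0 hD).ne'
  have hN : 0 < (acc₁ - acc₂) - (m₁ - m₂) := by
    have := mul_pos hmix1 hD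
    rwa [div_mul_cancel₀ _ hD.ne'] at this
  have hN2 := (div_lt_iff₀ hD).1 hmix2
  have hS : sStar ∈ Set.Ioo (0:ℝ) 1 := by
    rw [hs]
    exact ⟨div_pos (by linarith) hd, (div_lt_one hd).2 (by linarith)⟩
  have hR : rStar ∈ Set.Ioo (0:ℝ) 1 := by
    rw [hr]
    exact ⟨div_pos hN (mul_pos hm0 hD), (div_lt_one (mul_pos hm0 hD)).2 hN2⟩
  refine ⟨hS, hR, ⟨⟨hS.1.le, hS.2.le⟩, fun s _ => le_of_eq ?_⟩,
    ⟨⟨hR.1.le, hR.2.le⟩, fun r _ => le_of_eq ?_⟩⟩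
  · have e : EPPSdef acc₁ rob₁ O₁ Rpd Rmd rStar rmax = EPPSdef acc₂ rob₂ O₂ Rpd Rmd rStar rmax := by
      unfold EPPSdef CCR
      linear_combination hM1 - hM2 - (Rpd + Rmd) * hr'
    unfold UtilityDef
    rw [e]; ring
  · have e : -Oadv - Rma + (Rpa + Rma) * ASR rob₁ rob₂ sStar = 0 := by
      unfold ASR
      linear_combination hA + (Rpa + Rma) * hs'
    unfold UtilityAdv
    rw [e]; ring
end

section
/- Suppose rob₁ < 1 - μ^adv < rob₂ and 0 < (Δacc - Δμ^def)/(Δacc + Δrob) < r_max. Then the Nash equilibrium is unique: if (ŝ₁, r̂₁) ∈ [0,1]² is any Nash equilibrium, then ŝ₁ = (rob₂ - 1 + μ^adv)/Δrob and r̂₁ = (Δacc - Δμ^def)/(r_max·(Δacc + Δrob)). (Theorem 1, uniqueness part.) -/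
theorem aux_neg {A r : ℝ} (h : A < 0) (h0 : (0 - r) * A ≤ 0) (hr : 0 ≤ r) : r = 0 := by
  by_contra hne
  have : 0 < r := lt_of_le_of_ne hr (Ne.symm hne)
  nlinarith

theorem aux_pos {A r : ℝ} (h : 0 < A) (h0 : (1 - r) * A ≤ 0) (hr : r ≤ 1) : r = 1 := by
  by_contra hne
  have : r < 1 := lt_of_le_of_ne hr hne
  nlinarith

theorem stmt_13 (acc₁ acc₂ rob₁ rob₂ Oadv Rpa Rma Iadv O₁ O₂ Rpd Rmd Idef rmax : ℝ) (n : ℕ)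
    (hacc₁ : acc₁ ∈ Set.Icc (0:ℝ) 1) (hacc₂ : acc₂ ∈ Set.Icc (0:ℝ) 1)
    (hrob₁ : rob₁ ∈ Set.Icc (0:ℝ) 1) (hrob₂ : rob₂ ∈ Set.Icc (0:ℝ) 1)
    (h12 : acc₁ > acc₂) (h2r : acc₂ > rob₂) (hrr : rob₂ > rob₁)
    (hOa : 0 ≤ Oadv) (hRpa : 0 ≤ Rpa) (hRma : 0 ≤ Rma) (hRa : 0 < Rpa + Rma) (hIa : 0 ≤ Iadv)
    (hO₁ : 0 ≤ O₁) (hO₂ : 0 ≤ O₂) (hRpd : 0 ≤ Rpd) (hRmd : 0 ≤ Rmd) (hRd : 0 < Rpd + Rmd)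
    (hId : 0 ≤ Idef) (hn : 1 ≤ n) (hrmax : rmax ∈ Set.Ioc (0:ℝ) 1)
    (hmu1 : rob₁ < 1 - muAdv Oadv Rpa Rma) (hmu2 : 1 - muAdv Oadv Rpa Rma < rob₂)
    (hmix1 : 0 < ((acc₁ - acc₂) - (muDef O₁ Rpd Rmd - muDef O₂ Rpd Rmd)) /
      ((acc₁ - acc₂) + (rob₂ - rob₁)))
    (hmix2 : ((acc₁ - acc₂) - (muDef O₁ Rpd Rmd - muDef O₂ Rpd Rmd)) /
      ((acc₁ - acc₂) + (rob₂ - rob₁)) < rmax)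
    (sHat rHat : ℝ)
    (hNash : IsBestRespDef acc₁ acc₂ rob₁ rob₂ O₁ O₂ Rpd Rmd Idef n rmax rHat sHat ∧
      IsBestRespAdv rob₁ rob₂ Oadv Rpa Rma Iadv n rmax sHat rHat) :
    sHat = (rob₂ - 1 + muAdv Oadv Rpa Rma) / (rob₂ - rob₁) ∧
    rHat = ((acc₁ - acc₂) - (muDef O₁ Rpd Rmd - muDef O₂ Rpd Rmd)) /
      (rmax * ((acc₁ - acc₂) + (rob₂ - rob₁))) := by
  obtain ⟨⟨⟨hs0, hs1⟩, hD⟩, ⟨hr0, hr1⟩, hA⟩ := hNash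
  obtain ⟨hrm0, hrm1⟩ := hrmax
  have hn' : (0:ℝ) < n := by exact_mod_cast hn
  have hS : 0 < (acc₁ - acc₂) + (rob₂ - rob₁) := by linarith
  have hR : 0 < rob₂ - rob₁ := by linarith
  have ea : Oadv + Rma = muAdv Oadv Rpa Rma * (Rpa + Rma) := by
    unfold muAdv; field_simp
  have e1 : O₁ + Rmd = muDef O₁ Rpd Rmd * (Rpd + Rmd) := by
    unfold muDef; field_simp
  have e2 : O₂ + Rmd = muDef O₂ Rpd Rmd * (Rpd + Rmd) := by
    unfold muDef; field_simp
  generalize muAdv Oadv Rpa Rma = ma at *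
  generalize muDef O₁ Rpd Rmd = m1 at *
  generalize muDef O₂ Rpd Rmd = m2 at *
  have hN : 0 < (acc₁ - acc₂) - (m1 - m2) := (div_pos_iff_of_pos_right hS).1 hmix1
  have hN2 : (acc₁ - acc₂) - (m1 - m2) < rmax * ((acc₁ - acc₂) + (rob₂ - rob₁)) :=
    (div_lt_iff₀ hS).1 hmix2
  obtain ⟨A, hAdef⟩ : ∃ A, A = sHat * (rob₂ - rob₁) - (rob₂ - 1 + ma) := ⟨_, rfl⟩
  obtain ⟨D, hDdef⟩ : ∃ D, D = (acc₁ - acc₂) - (m1 - m2)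
    - rHat * (rmax * ((acc₁ - acc₂) + (rob₂ - rob₁))) := ⟨_, rfl⟩
  have hA' : ∀ r ∈ Set.Icc (0:ℝ) 1, (r - rHat) * A ≤ 0 := by
    intro r hr
    have h := hA r hr
    unfold UtilityAdv ASR at h
    have hK : 0 < (n:ℝ) * rmax * (Rpa + Rma) := by positivity
    have : ((n:ℝ) * rmax * (Rpa + Rma)) * ((r - rHat) * A) ≤ 0 := by
      rw [hAdef]
      have e : Oadv = ma * (Rpa + Rma) - Rma := by linarith
      rw [e] at h
      linarith
    exact nonpos_of_mul_nonpos_right this hK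
  have hD' : ∀ s ∈ Set.Icc (0:ℝ) 1, (s - sHat) * D ≤ 0 := by
    intro s hs
    have h := hD s hs
    unfold UtilityDef EPPSdef CCR at h
    have hK : 0 < (n:ℝ) * (Rpd + Rmd) := by positivity
    have : ((n:ℝ) * (Rpd + Rmd)) * ((s - sHat) * D) ≤ 0 := by
      rw [hDdef]
      have e : O₁ = m1 * (Rpd + Rmd) - Rmd := by linarith
      have e' : O₂ = m2 * (Rpd + Rmd) - Rmd := by linarith
      rw [e, e'] at h
      linarith
    exact nonpos_of_mul_nonpos_right this hK
  have A0 := hA' 0 ⟨le_rfl, zero_le_one⟩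
  have A1 := hA' 1 ⟨zero_le_one, le_rfl⟩
  have D0 := hD' 0 ⟨le_rfl, zero_le_one⟩
  have D1 := hD' 1 ⟨zero_le_one, le_rfl⟩
  have hAz : A = 0 := by
    rcases lt_trichotomy A 0 with h | h | h
    · have hr : rHat = 0 := aux_neg h A0 hr0
      subst hr
      have hDp : 0 < D := by rw [hDdef]; linarith
      have hs : sHat = 1 := aux_pos hDp D1 hs1
      subst hs
      linarith
    · exact h
    · have hr : rHat = 1 := aux_pos h A1 hr1
      subst hr
      have hDp : D < 0 := by rw [hDdef]; linarith
      have hs : sHat = 0 := aux_neg hDp D0 hs0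
      subst hs
      linarith
  have hsp : 0 < sHat := by
    have h : 0 < sHat * (rob₂ - rob₁) := by linarith
    exact (mul_pos_iff_of_pos_right hR).1 h
  have hsl : sHat < 1 := by
    have h : sHat * (rob₂ - rob₁) < 1 * (rob₂ - rob₁) := by linarith
    exact lt_of_mul_lt_mul_right h hR.le
  have hDz : D = 0 := by
    rcases lt_trichotomy D 0 with h | h | h
    · exact absurd (aux_neg h D0 hs0) hsp.ne'
    · exact h
    · exact absurd (aux_pos h D1 hs1) hsl.ne
  constructor
  · rw [eq_div_iff hR.ne']; linarith
  · rw [eq_div_iff (mul_pos hrm0 hS).ne']; linarith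
end
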